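/- arXiv:0709.0498 — 3 statements merged into one kernel-verified Lean document; each statement's English description precedes it below -/
import Mathlib

section
/- Fix integers n ≥ 1 and p,q ≥ 0. Let β_n be the number of permutations σ of {1,…,2n+1+p+q} whose descent set {i : σ(i) > σ(i+1)} is exactly {1,2,…,p} ∪ {p+1, p+3, p+5, …, p+2n−1}. Then β_n = (2n+1+p+q)! · X_{2n}(p,q). -/
/-- The number of up-down (alternating) permutations of `{1, …, j}`:
permutations with `σ(1) < σ(2) > σ(3) < σ(4) > ⋯`. -/
noncomputable def updownCount (j : ℕ) : ℕ :=
  Nat.card {σ : Equiv.Perm (Fin j) //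
    ∀ i : Fin j, ∀ h : (i : ℕ) + 1 < j,
      if (i : ℕ) % 2 = 0 then σ i < σ ⟨(i : ℕ) + 1, h⟩
      else σ ⟨(i : ℕ) + 1, h⟩ < σ i}

/-- `Ā_j = A_j / j!`. -/
noncomputable def Abar (j : ℕ) : ℝ := (updownCount j : ℝ) / (Nat.factorial j : ℝ)

/-- The quantity `X_N(p,q)` of Romik–Eremenko. -/
noncomputable def XN (N p q : ℕ) : ℝ :=
  (∑ i ∈ Finset.range (p / 2 + 1), ∑ j ∈ Finset.range (q / 2 + 1),
      (-1 : ℝ) ^ (i + j) * Abar (N + 2 * i + 2 * j + 1) /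
        ((Nat.factorial (p - 2 * i) : ℝ) * (Nat.factorial (q - 2 * j) : ℝ)))
  + (if Odd p then
      (-1 : ℝ) ^ ((p + 1) / 2) * ∑ j ∈ Finset.range (q / 2 + 1),
        (-1 : ℝ) ^ j * Abar (N + p + 2 * j + 1) / (Nat.factorial (q - 2 * j) : ℝ)
    else 0)
  + (if Odd q then
      (-1 : ℝ) ^ ((q + 1) / 2) * ∑ i ∈ Finset.range (p / 2 + 1),
        (-1 : ℝ) ^ i * Abar (N + q + 2 * i + 1) / (Nat.factorial (p - 2 * i) : ℝ)
    else 0)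
  + (if Odd p ∧ Odd q then (-1 : ℝ) ^ ((p + q) / 2 + 1) * Abar (N + p + q + 1) else 0)

/-- The number of permutations of `{1, …, m}` whose descent set (with positions
indexed `1, …, m−1`) is exactly the set `S`. -/
noncomputable def descentSetCount (m : ℕ) (S : Finset ℕ) : ℕ :=
  Nat.card {σ : Equiv.Perm (Fin m) //
    ∀ i : Fin m, ∀ h : (i : ℕ) + 1 < m,
      (σ ⟨(i : ℕ) + 1, h⟩ < σ i ↔ (i : ℕ) + 1 ∈ S)}

open Finset in
def Pat {α : Type*} [LT α] (m : ℕ) (s : ℕ → Prop) (f : Fin m → α) : Prop :=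
  ∀ i : Fin m, ∀ h : (i : ℕ) + 1 < m, (f ⟨(i : ℕ) + 1, h⟩ < f i ↔ s i)

noncomputable def cnt (m : ℕ) (s : ℕ → Prop) : ℕ :=
  Nat.card {σ : Equiv.Perm (Fin m) // Pat m s σ}

noncomputable def bb (m : ℕ) (s : ℕ → Prop) : ℝ := (cnt m s : ℝ) / (Nat.factorial m : ℝ)

lemma Pat_congr {α : Type*} [LT α] {m : ℕ} {s t : ℕ → Prop} (f : Fin m → α)
    (h : ∀ i, i + 1 < m → (s i ↔ t i)) : Pat m s f ↔ Pat m t f := by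
  unfold Pat
  refine forall_congr' fun i => forall_congr' fun hi => ?_
  rw [h i hi]

lemma bb_congr {m : ℕ} {s t : ℕ → Prop} (h : ∀ i, i + 1 < m → (s i ↔ t i)) :
    bb m s = bb m t := by
  unfold bb cnt
  simp only [fun σ : Equiv.Perm (Fin m) => Pat_congr (σ : Fin m → Fin m) h]

lemma bb_congr' {m m' : ℕ} {s t : ℕ → Prop} (hm : m = m') (h : ∀ i, i + 1 < m → (s i ↔ t i)) :
    bb m s = bb m' t := by
  subst hm; exact bb_congr h

/-- complement -/
lemma bb_compl (m : ℕ) (s : ℕ → Prop) : bb m (fun i => ¬ s i) = bb m s := by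
  unfold bb cnt
  congr 2
  refine Nat.card_congr (Equiv.subtypeEquiv
    (Equiv.mulLeft (Fin.revPerm : Equiv.Perm (Fin m))) fun σ => ?_)
  unfold Pat
  refine forall_congr' fun i => forall_congr' fun hi => ?_
  simp only [Equiv.coe_mulLeft, Equiv.Perm.coe_mul, Function.comp, Fin.revPerm_apply,
    Fin.rev_lt_rev]
  have : σ i ≠ σ ⟨(i : ℕ) + 1, hi⟩ := by
    intro h
    have := congrArg Fin.val (σ.injective h)
    simp at this
  have h2 : σ i < σ ⟨(i : ℕ) + 1, hi⟩ ↔ ¬ σ ⟨(i : ℕ) + 1, hi⟩ < σ i := by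
    rw [not_lt]; exact ⟨le_of_lt, fun h => lt_of_le_of_ne h this⟩
  rw [h2]; tauto

lemma card_inj {α : Type*} [LinearOrder α] (a : ℕ) (s : ℕ → Prop) (f : Fin a → α)
    (hf : Function.Injective f) :
    Nat.card {τ : Equiv.Perm (Fin a) // Pat a s (f ∘ τ)} = cnt a s := by
  symm
  refine Nat.card_congr (Equiv.subtypeEquiv (Equiv.mulLeft (Tuple.sort f)) fun σ => ?_)
  have hm : StrictMono (f ∘ Tuple.sort f) :=
    (Tuple.monotone_sort f).strictMono_of_injective (hf.comp (Tuple.sort f).injective)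
  unfold Pat
  refine forall_congr' fun i => forall_congr' fun hi => ?_
  rw [← hm.lt_iff_lt]
  rfl

def PatOff (a c : ℕ) (s1 s2 : ℕ → Prop) {α : Type*} [LT α] (f : Fin (a + c) → α) : Prop :=
  Pat a s1 (f ∘ Fin.castAdd c) ∧ Pat c s2 (f ∘ Fin.natAdd a)

noncomputable def blk (a c : ℕ) (τ : Equiv.Perm (Fin a) × Equiv.Perm (Fin c)) :
    Equiv.Perm (Fin (a + c)) :=
  finSumFinEquiv.symm.trans ((Equiv.sumCongr τ.1 τ.2).trans finSumFinEquiv)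

lemma blk_count (a c : ℕ) (s1 s2 : ℕ → Prop) :
    Nat.card {σ : Equiv.Perm (Fin (a + c)) // PatOff a c s1 s2 σ} * (a.factorial * c.factorial)
      = (a + c).factorial * (cnt a s1 * cnt c s2) := by
  classical
  have e1 : Nat.card {x : Equiv.Perm (Fin (a + c)) × (Equiv.Perm (Fin a) × Equiv.Perm (Fin c)) //
      PatOff a c s1 s2 (x.1 * blk a c x.2 : Equiv.Perm (Fin (a + c)))} =
      Nat.card {σ : Equiv.Perm (Fin (a + c)) // PatOff a c s1 s2 σ} * (a.factorial * c.factorial) := by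
    have : a.factorial * c.factorial = Nat.card (Equiv.Perm (Fin a) × Equiv.Perm (Fin c)) := by
      simp [Nat.card_prod, Fintype.card_perm]
    rw [this, ← Nat.card_prod]
    refine Nat.card_congr ⟨fun x => (⟨x.1.1 * blk a c x.1.2, x.2⟩, x.1.2),
      fun y => ⟨(y.1.1 * (blk a c y.2)⁻¹, y.2), by simpa using y.1.2⟩, fun x => ?_, fun y => ?_⟩
    · apply Subtype.ext; simp
    · simp
  have e2 : Nat.card {x : Equiv.Perm (Fin (a + c)) × (Equiv.Perm (Fin a) × Equiv.Perm (Fin c)) //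
      PatOff a c s1 s2 (x.1 * blk a c x.2 : Equiv.Perm (Fin (a + c)))} =
      (a + c).factorial * (cnt a s1 * cnt c s2) := by
    rw [Nat.card_congr (Equiv.subtypeProdEquivSigmaSubtype
      (fun (σ : Equiv.Perm (Fin (a + c))) (τ : Equiv.Perm (Fin a) × Equiv.Perm (Fin c)) =>
        PatOff a c s1 s2 (σ * blk a c τ : Equiv.Perm (Fin (a + c))))), Nat.card_sigma]
    rw [Finset.sum_congr rfl (g := fun _ => cnt a s1 * cnt c s2)]
    · simp [Fintype.card_perm]
    · intro σ _
      rw [← card_inj a s1 (σ ∘ Fin.castAdd c) (σ.injective.comp (Fin.castAdd_injective a c)),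
        ← card_inj c s2 (σ ∘ Fin.natAdd a) (σ.injective.comp (Fin.natAdd_injective c a)),
        ← Nat.card_prod]
      refine Nat.card_congr ((Equiv.subtypeEquivRight fun τ => ?_).trans
        Equiv.subtypeProdEquivProd)
      unfold PatOff
      have h1 : ((σ * blk a c τ : Equiv.Perm (Fin (a + c))) : Fin (a + c) → Fin (a + c)) ∘
          Fin.castAdd c = (σ ∘ Fin.castAdd c) ∘ τ.1 := by
        funext i; simp [blk]
      have h2 : ((σ * blk a c τ : Equiv.Perm (Fin (a + c))) : Fin (a + c) → Fin (a + c)) ∘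
          Fin.natAdd a = (σ ∘ Fin.natAdd a) ∘ τ.2 := by
        funext i; simp [blk]
      rw [h1, h2]
  rw [← e1, e2]

/-- inserting either letter at the junction -/
def join (a : ℕ) (P : Prop) (s1 s2 : ℕ → Prop) (i : ℕ) : Prop :=
  if i + 1 < a then s1 i else if i + 1 = a then P else s2 (i - a)

lemma pat_join (a c : ℕ) (ha : 1 ≤ a) (hc : 1 ≤ c) (P : Prop) (s1 s2 : ℕ → Prop)
    (f : Fin (a + c) → Fin (a + c)) :
    Pat (a + c) (join a P s1 s2) f ↔
      PatOff a c s1 s2 f ∧ (f ⟨a, by omega⟩ < f ⟨a - 1, by omega⟩ ↔ P) := by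
  constructor
  · intro h
    refine ⟨⟨fun i hi => ?_, fun i hi => ?_⟩, ?_⟩
    · have := h (Fin.castAdd c i) (by simp; omega)
      simp only [join, Fin.val_castAdd, hi, if_true] at this
      exact this
    · have := h (Fin.natAdd a i) (by simp; omega)
      simp only [join, Fin.val_natAdd] at this
      rw [if_neg (by omega), if_neg (by omega), Nat.add_sub_cancel_left] at this
      exact this
    · have := h ⟨a - 1, by omega⟩ (by simp; omega)
      simp only [join] at this
      rw [if_neg (by omega), if_pos (by omega)] at this
      rw [← this]
      have e : (⟨a, by omega⟩ : Fin (a + c)) = ⟨a - 1 + 1, by omega⟩ := by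
        apply Fin.ext; simp; omega
      rw [e]
  · rintro ⟨⟨h1, h2⟩, h3⟩ ⟨i, hi'⟩ hi
    simp only at hi
    unfold join
    rcases lt_trichotomy (i + 1) a with h | h | h
    · rw [if_pos h]; exact h1 ⟨i, by omega⟩ h
    · subst h
      simp only [lt_irrefl, if_false, if_true]
      exact h3
    · rw [if_neg (by simp; omega), if_neg (by simp; omega)]
      obtain ⟨k, rfl⟩ : ∃ k, i = a + k := ⟨i - a, by omega⟩
      have := h2 ⟨k, by omega⟩ (by simp; omega)
      simp only [Nat.add_sub_cancel_left]
      exact this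

lemma bb_mul (a c : ℕ) (ha : 1 ≤ a) (hc : 1 ≤ c) (s1 s2 : ℕ → Prop) :
    bb a s1 * bb c s2 = bb (a + c) (join a True s1 s2) + bb (a + c) (join a False s1 s2) := by
  classical
  have key := blk_count a c s1 s2
  have hs : Nat.card {σ : Equiv.Perm (Fin (a + c)) // PatOff a c s1 s2 σ} =
      cnt (a + c) (join a True s1 s2) + cnt (a + c) (join a False s1 s2) := by
    unfold cnt
    simp only [fun P (σ : Equiv.Perm (Fin (a + c))) =>
      pat_join a c ha hc P s1 s2 (σ : Fin (a + c) → Fin (a + c)), iff_true, iff_false]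
    simp only [Nat.card_eq_fintype_card, Fintype.card_subtype]
    rw [← Finset.filter_filter, ← Finset.filter_filter, Finset.card_filter_add_card_filter_not]
  rw [hs] at key
  unfold bb
  have h1 : (a.factorial : ℝ) ≠ 0 := by positivity
  have h2 : (c.factorial : ℝ) ≠ 0 := by positivity
  have h3 : ((a + c).factorial : ℝ) ≠ 0 := by positivity
  have key' : (((cnt (a + c) (join a True s1 s2) : ℝ) + cnt (a + c) (join a False s1 s2)) *
    (a.factorial * c.factorial)) = (a + c).factorial * (cnt a s1 * cnt c s2) := by exact_mod_cast key
  field_simp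
  linarith

lemma bb_split (a c m : ℕ) (s1 s2 s t : ℕ → Prop) (ha : 1 ≤ a) (hc : 1 ≤ c) (hm : a + c = m)
    (hs : ∀ i, i + 1 < m → (s i ↔ join a True s1 s2 i))
    (ht : ∀ i, i + 1 < m → (t i ↔ join a False s1 s2 i)) :
    bb m s + bb m t = bb a s1 * bb c s2 := by
  subst hm
  rw [bb_mul a c ha hc, bb_congr hs, bb_congr ht]

lemma bb_false (m : ℕ) : bb m (fun _ => False) = 1 / (m.factorial : ℝ) := by
  have : cnt m (fun _ => False) = 1 := by
    unfold cnt
    rw [Nat.card_eq_one_iff_unique]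
    refine ⟨⟨fun x y => ?_⟩, ⟨⟨1, fun i h => by simp [Fin.le_def]⟩⟩⟩
    have key : ∀ z : {σ : Equiv.Perm (Fin m) // Pat m (fun _ => False) σ}, z.1 = 1 := by
      rintro ⟨σ, h⟩
      have hmono : StrictMono σ := by
        rcases m with _ | m
        · intro a; exact a.elim0
        · rw [Fin.strictMono_iff_lt_succ]
          intro i
          have := h i.castSucc (by simp)
          simp only [iff_false, not_lt] at this
          refine lt_of_le_of_ne this fun e => ?_
          have := congrArg Fin.val (σ.injective e)
          simp at this
      ext i
      have := Subsingleton.elim (hmono.orderIsoOfSurjective σ σ.surjective) (OrderIso.refl _)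
      have := congrArg (fun e => (e i : ℕ)) this
      simpa using this
    apply Subtype.ext
    rw [key x, key y]
  unfold bb
  rw [this]; simp

lemma bb_true (m : ℕ) : bb m (fun _ => True) = 1 / (m.factorial : ℝ) := by
  rw [← bb_false, ← bb_compl m (fun _ => False)]
  exact bb_congr (by simp)

lemma Abar_eq (m : ℕ) : Abar m = bb m (fun i => i % 2 = 1) := by
  unfold Abar bb
  congr 2
  unfold updownCount cnt
  refine Nat.card_congr (Equiv.subtypeEquivRight fun σ => ?_)
  unfold Pat
  refine forall_congr' fun i => forall_congr' fun hi => ?_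
  have : σ i ≠ σ ⟨(i : ℕ) + 1, hi⟩ := by
    intro h
    have := congrArg Fin.val (σ.injective h)
    simp at this
  rcases Nat.mod_two_eq_zero_or_one (i : ℕ) with h | h
  · simp only [h, if_true]
    simp
    exact ⟨le_of_lt, fun h => lt_of_le_of_ne h this⟩
  · simp [h]

lemma Abar_eq' (m N : ℕ) : Abar m = bb m (fun i => i % 2 = N % 2) := by
  rw [Abar_eq]
  rcases Nat.mod_two_eq_zero_or_one N with h | h
  · rw [← bb_compl]
    exact bb_congr (by intro i _; omega)
  · rw [h]

def hs (N i : ℕ) : Prop := i < N ∧ i % 2 = N % 2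

noncomputable def hh (N q : ℕ) : ℝ := bb (N + 1 + q) (hs N)

lemma hh_zero (N : ℕ) : hh N 0 = Abar (N + 1) := by
  rw [Abar_eq' _ N]
  exact bb_congr (by unfold hs; intro i _; omega)

lemma hh_aux (N q : ℕ) (hq : 1 ≤ q) :
    bb (N + 1 + q) (hs (N + 2)) + hh N q = Abar (N + 1) / q.factorial := by
  rw [← hh_zero, div_eq_mul_one_div, ← bb_false]
  refine bb_split (N + 1) q _ (hs N) (fun _ => False) _ _ (by omega) hq rfl ?_ ?_
  · intro i hi; unfold join hs; split_ifs <;> simp <;> omega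
  · intro i hi; unfold join hs; split_ifs <;> simp <;> omega

lemma hh_one (N : ℕ) : hh N 1 = Abar (N + 1) - Abar (N + 2) := by
  have := hh_aux N 1 le_rfl
  have h2 : bb (N + 1 + 1) (hs (N + 2)) = Abar (N + 2) := by
    rw [Abar_eq' _ N]
    exact bb_congr (by unfold hs; intro i _; omega)
  rw [h2] at this
  simp at this; linarith

lemma hh_add_two (N q : ℕ) :
    hh N (q + 2) = Abar (N + 1) / (q + 2).factorial - hh (N + 2) q := by
  have := hh_aux N (q + 2) (by omega)
  have h2 : bb (N + 1 + (q + 2)) (hs (N + 2)) = hh (N + 2) q :=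
    bb_congr' (by omega) (by simp)
  rw [h2] at this
  linarith

def fs (n p i : ℕ) : Prop := i < p ∨ (i < p + 2 * n ∧ i % 2 = p % 2)

noncomputable def ff (n p q : ℕ) : ℝ := bb (2 * n + 1 + p + q) (fs n p)

lemma ff_zero (n q : ℕ) : ff n 0 q = hh (2 * n) q :=
  bb_congr' (by omega) (by intro i _; unfold fs hs; omega)

lemma ff_aux (n p q : ℕ) (hp : 1 ≤ p) :
    ff n p q + bb (2 * n + 1 + p + q) (fun i => i + 1 < p ∨ (p ≤ i ∧ i < p + 2 * n ∧ i % 2 = p % 2))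
      = hh (2 * n) q / p.factorial := by
  rw [div_eq_mul_one_div, ← bb_true, mul_comm (hh (2 * n) q)]
  unfold ff hh
  refine bb_split p (2 * n + 1 + q) _ (fun _ => True) (hs (2 * n)) _ _ hp (by omega) (by omega) ?_ ?_
  · intro i hi; unfold join hs fs; split_ifs <;> simp <;> omega
  · intro i hi; unfold join hs; split_ifs <;> simp <;> omega

lemma ff_one (n q : ℕ) : ff n 1 q = hh (2 * n) q - hh (2 * n + 1) q := by
  have := ff_aux n 1 q le_rfl
  have h2 : bb (2 * n + 1 + 1 + q)
      (fun i => i + 1 < 1 ∨ (1 ≤ i ∧ i < 1 + 2 * n ∧ i % 2 = 1 % 2)) = hh (2 * n + 1) q := by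
    unfold hh
    exact bb_congr' (by omega) (by intro i _; unfold hs; omega)
  rw [h2] at this
  simp at this; linarith

lemma ff_add_two (n p q : ℕ) :
    ff n (p + 2) q = hh (2 * n) q / (p + 2).factorial - ff (n + 1) p q := by
  have := ff_aux n (p + 2) q (by omega)
  have h2 : bb (2 * n + 1 + (p + 2) + q)
      (fun i => i + 1 < p + 2 ∨ (p + 2 ≤ i ∧ i < p + 2 + 2 * n ∧ i % 2 = (p + 2) % 2)) =
      ff (n + 1) p q := by
    unfold ff
    exact bb_congr' (by omega) (by intro i _; unfold fs; omega)
  rw [h2] at this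
  linarith

lemma odd_rec (g h : ℕ → ℕ → ℝ) (a : ℕ → ℝ)
    (h0 : ∀ N, g N 0 = a N) (h1 : ∀ N, g N 1 = a N - a (N + 1))
    (h2 : ∀ N q, g N (q + 2) = a N / (q + 2).factorial - g (N + 2) q) (q : ℕ) : ∀ N,
    g N q = (∑ j ∈ Finset.range (q / 2 + 1), (-1 : ℝ) ^ j * a (N + 2 * j) / ((q - 2 * j).factorial : ℝ))
      + if Odd q then (-1 : ℝ) ^ ((q + 1) / 2) * a (N + q) else 0 := by
  induction q using Nat.strong_induction_on with
  | _ q ih =>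
    intro N
    match q, ih with
    | 0, _ => simp [h0]
    | 1, _ => simp [h1]; ring
    | q + 2, ih =>
      rw [h2, ih q (by omega), show (q + 2) / 2 + 1 = (q / 2 + 1) + 1 by omega,
        Finset.sum_range_succ' _ (q / 2 + 1)]
      have e1 : ∀ j, (-1 : ℝ) ^ (j + 1) * a (N + 2 * (j + 1)) / ((q + 2 - 2 * (j + 1)).factorial : ℝ)
          = - ((-1 : ℝ) ^ j * a (N + 2 + 2 * j) / ((q - 2 * j).factorial : ℝ)) := by
        intro j
        rw [show N + 2 * (j + 1) = N + 2 + 2 * j by ring,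
          show q + 2 - 2 * (j + 1) = q - 2 * j by omega]
        ring
      simp only [e1, Finset.sum_neg_distrib]
      have e2 : Odd (q + 2) ↔ Odd q := by simp [Nat.odd_iff]
      simp only [e2]
      rw [show (q + 2 + 1) / 2 = (q + 1) / 2 + 1 by omega, show N + (q + 2) = N + 2 + q by ring]
      split_ifs <;> simp <;> ring

lemma hh_eq (N q : ℕ) : hh N q =
    (∑ j ∈ Finset.range (q / 2 + 1), (-1 : ℝ) ^ j * Abar (N + 2 * j + 1) / ((q - 2 * j).factorial : ℝ))
      + if Odd q then (-1 : ℝ) ^ ((q + 1) / 2) * Abar (N + q + 1) else 0 :=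
  odd_rec hh hh (fun N => Abar (N + 1)) hh_zero hh_one hh_add_two q N

lemma ff_eq (q p : ℕ) : ∀ n, ff n p q =
    (∑ i ∈ Finset.range (p / 2 + 1), (-1 : ℝ) ^ i * hh (2 * n + 2 * i) q / ((p - 2 * i).factorial : ℝ))
      + if Odd p then (-1 : ℝ) ^ ((p + 1) / 2) * hh (2 * n + p) q else 0 := by
  induction p using Nat.strong_induction_on with
  | _ p ih =>
    intro n
    match p, ih with
    | 0, _ => simp [ff_zero]
    | 1, _ => simp [ff_one]; ring
    | p + 2, ih =>
      rw [ff_add_two, ih p (by omega), show (p + 2) / 2 + 1 = (p / 2 + 1) + 1 by omega,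
        Finset.sum_range_succ' _ (p / 2 + 1)]
      have e1 : ∀ j, (-1 : ℝ) ^ (j + 1) * hh (2 * n + 2 * (j + 1)) q / ((p + 2 - 2 * (j + 1)).factorial : ℝ)
          = - ((-1 : ℝ) ^ j * hh (2 * (n + 1) + 2 * j) q / ((p - 2 * j).factorial : ℝ)) := by
        intro j
        rw [show 2 * n + 2 * (j + 1) = 2 * (n + 1) + 2 * j by ring,
          show p + 2 - 2 * (j + 1) = p - 2 * j by omega]
        ring
      simp only [e1, Finset.sum_neg_distrib]
      have e2 : Odd (p + 2) ↔ Odd p := by simp [Nat.odd_iff]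
      simp only [e2]
      rw [show (p + 2 + 1) / 2 = (p + 1) / 2 + 1 by omega,
        show 2 * n + (p + 2) = 2 * (n + 1) + p by ring]
      split_ifs <;> simp <;> ring

lemma ff_eq_XN (n p q : ℕ) : ff n p q = XN (2 * n) p q := by
  rw [ff_eq]
  unfold XN
  simp only [hh_eq]
  have e : ∀ i, (-1 : ℝ) ^ i * ((∑ j ∈ Finset.range (q / 2 + 1),
      (-1 : ℝ) ^ j * Abar (2 * n + 2 * i + 2 * j + 1) / ((q - 2 * j).factorial : ℝ))
      + if Odd q then (-1 : ℝ) ^ ((q + 1) / 2) * Abar (2 * n + 2 * i + q + 1) else 0)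
        / ((p - 2 * i).factorial : ℝ) =
      (∑ j ∈ Finset.range (q / 2 + 1), (-1 : ℝ) ^ (i + j) * Abar (2 * n + 2 * i + 2 * j + 1) /
        ((Nat.factorial (p - 2 * i) : ℝ) * (Nat.factorial (q - 2 * j) : ℝ))) +
      (if Odd q then (-1 : ℝ) ^ ((q + 1) / 2) *
        ((-1 : ℝ) ^ i * Abar (2 * n + q + 2 * i + 1) / (Nat.factorial (p - 2 * i) : ℝ)) else 0) := by
    intro i
    rw [mul_add, add_div, Finset.mul_sum, Finset.sum_div]
    congr 1
    · refine Finset.sum_congr rfl fun j _ => ?_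
      rw [pow_add]
      field_simp
    · rw [show 2 * n + 2 * i + q + 1 = 2 * n + q + 2 * i + 1 by ring]
      split_ifs
      · ring
      · simp
  simp only [e, Finset.sum_add_distrib]
  by_cases hp : Odd p <;> by_cases hq : Odd q <;>
    simp only [hp, hq, if_true, if_false, and_true, and_false, Finset.sum_const_zero, ← Finset.mul_sum]
  · have : (p + q) / 2 + 1 = (p + 1) / 2 + (q + 1) / 2 := by
      rw [Nat.odd_iff] at hp hq; omega
    rw [this, pow_add]; ring
  · ring
  · ring
  · ring

/-- The number `β_n` of permutations of `{1, …, 2n+1+p+q}` with descent set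
`{1,…,p} ∪ {p+1, p+3, …, p+2n−1}` equals `(2n+1+p+q)! · X_{2n}(p,q)`. -/
theorem beta_eq (n p q : ℕ) (hn : 1 ≤ n) :
    (descentSetCount (2 * n + 1 + p + q)
        (Finset.Icc 1 p ∪ (Finset.range n).image (fun j => p + 2 * j + 1)) : ℝ) =
      (Nat.factorial (2 * n + 1 + p + q) : ℝ) * XN (2 * n) p q := by
  rw [← ff_eq_XN]
  unfold ff bb
  rw [mul_div_cancel₀ _ (by positivity)]
  congr 1
  unfold descentSetCount cnt
  refine Nat.card_congr (Equiv.subtypeEquivRight fun σ => ?_)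
  unfold Pat
  refine forall_congr' fun i => forall_congr' fun hi => ?_
  have : (i : ℕ) + 1 ∈ (Finset.Icc 1 p ∪ (Finset.range n).image (fun j => p + 2 * j + 1)) ↔
      fs n p i := by
    simp only [Finset.mem_union, Finset.mem_Icc, Finset.mem_image, Finset.mem_range, fs]
    constructor
    · rintro (h | ⟨j, hj, h⟩) <;> omega
    · rintro (h | ⟨h1, h2⟩)
      · left; omega
      · by_cases h : (i : ℕ) < p
        · left; omega
        · right; exact ⟨(i - p) / 2, by omega, by omega⟩
  rw [this]
end

section
/- Fix an integer k ≥ 1. The family of functions φ_{j_1,…,j_k}(x_1,…,x_k) = 2^{k/2} · det( cos(π(2j_p−1)x_q/2) )_{1≤p,q≤k}, indexed by integer tuples j_1 > j_2 > … > j_k > 0 and regarded as elements of L²(Ω_k) with Ω_k = {x ∈ [0,1]^k : x_1 ≤ x_2 ≤ … ≤ x_k} equipped with Lebesgue measure, is a complete orthonormal system: distinct tuples give orthogonal functions, each φ_{j_1,…,j_k} has L²(Ω_k)-norm 1, and the closed linear span of the family is all of L²(Ω_k). -/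
open MeasureTheory

/-- The order simplex `Ω_k = {x ∈ [0,1]^k : x_1 ≤ x_2 ≤ … ≤ x_k}`. -/
def orderSimplex (k : ℕ) : Set (Fin k → ℝ) :=
  {x | (∀ q, 0 ≤ x q ∧ x q ≤ 1) ∧ Monotone x}

/-- The function `φ_{j_1,…,j_k}(x) = 2^{k/2} det( cos(π(2j_p−1)x_q/2) )_{p,q}`. -/
noncomputable def phiCos (k : ℕ) (jj : Fin k → ℕ) (x : Fin k → ℝ) : ℝ :=
  Real.sqrt 2 ^ k *
    Matrix.det (Matrix.of fun p q : Fin k =>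
      Real.cos (Real.pi * (2 * (jj p : ℝ) - 1) * x q / 2))

section aux

theorem aux_alg {X : Type*} [TopologicalSpace X] [CompactSpace X] [MeasurableSpace X]
    [BorelSpace X] (μ : Measure X) (k : ℕ) (C : Fin k → ℕ → C(X, ℝ)) (u : Fin k → C(X, ℝ))
    (F : X → ℝ) (hF : Integrable F μ)
    (h : ∀ j : Fin k → ℕ, (∀ p, 0 < j p) → ∫ x, (∏ p, C p (j p)) x * F x ∂μ = 0)
    (hrec : ∀ p j, 0 < j → ∃ a b, 0 < a ∧ 0 < b ∧
      u p * C p j = (1 / 2 : ℝ) • (C p a + C p b))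
    (hsep : ∀ x y : X, (∀ p, u p x = u p y) → x = y)
    (g : C(X, ℝ)) (j : Fin k → ℕ) (hj : ∀ p, 0 < j p) :
    ∫ x, (g * ∏ p, C p (j p)) x * F x ∂μ = 0 := by
  have hint : ∀ g : C(X, ℝ), Integrable (fun x => g x * F x) μ := fun g =>
    hF.bdd_mul g.continuous.aestronglyMeasurable (c := ‖g‖)
      (Filter.Eventually.of_forall fun x => g.norm_coe_le_norm x)
  let T : C(X, ℝ) →ₗ[ℝ] ℝ :=
    { toFun := fun g => ∫ x, g x * F x ∂μ
      map_add' := fun a b => by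
        rw [← integral_add (hint a) (hint b)]
        congr 1; ext x; simp [add_mul]
      map_smul' := fun r a => by
        simp only [ContinuousMap.coe_smul, Pi.smul_apply, smul_eq_mul, RingHom.id_apply,
          mul_assoc]
        rw [integral_const_mul] }
  have hT : ∀ g, T g = ∫ x, g x * F x ∂μ := fun g => rfl
  have hTc : Continuous T := by
    refine (T.mkContinuous (∫ x, ‖F x‖ ∂μ) ?_).continuous
    intro g
    rw [hT, mul_comm, ← integral_const_mul]
    refine norm_integral_le_of_norm_le (hF.norm.const_mul _) ?_
    refine Filter.Eventually.of_forall fun x => ?_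
    rw [norm_mul]
    exact mul_le_mul_of_nonneg_right (g.norm_coe_le_norm x) (norm_nonneg _)
  let A : Submodule ℝ C(X, ℝ) :=
    { carrier := {g | ∀ j : Fin k → ℕ, (∀ p, 0 < j p) → T (g * ∏ p, C p (j p)) = 0}
      add_mem' := by
        intro a b ha hb j hj
        rw [add_mul, map_add, ha j hj, hb j hj, add_zero]
      zero_mem' := by intro j hj; simp
      smul_mem' := by
        intro r a ha j hj
        rw [smul_mul_assoc, map_smul, ha j hj, smul_zero] }
  have hAc : IsClosed (A : Set C(X, ℝ)) := by
    have : (A : Set C(X, ℝ)) = ⋂ j : Fin k → ℕ, ⋂ _ : (∀ p, 0 < j p),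
        {g | T (g * ∏ p, C p (j p)) = 0} := by
      ext g; simp [A]
    rw [this]
    refine isClosed_iInter fun j => isClosed_iInter fun _ => ?_
    exact isClosed_eq (hTc.comp (continuous_mul_const _)) continuous_const
  let B : Subalgebra ℝ C(X, ℝ) :=
    { carrier := {b | ∀ g ∈ A, b * g ∈ A}
      add_mem' := by
        intro a b ha hb g hg
        rw [add_mul]; exact A.add_mem (ha g hg) (hb g hg)
      mul_mem' := by
        intro a b ha hb g hg
        rw [mul_assoc]; exact ha _ (hb g hg)
      algebraMap_mem' := by
        intro r g hg
        rw [← Algebra.smul_def]; exact A.smul_mem r hg }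
  have hBc : IsClosed (B : Set C(X, ℝ)) := by
    have : (B : Set C(X, ℝ)) = ⋂ g ∈ A, {b | b * g ∈ A} := by
      ext g; simp [B]
    rw [this]
    exact isClosed_biInter fun g _ => hAc.preimage (continuous_mul_const g)
  have hu : ∀ p, u p ∈ B := by
    intro p g hg j hj
    obtain ⟨a, b, ha, hb, hab⟩ := hrec p (j p) (hj p)
    have key : ∀ a, ∏ q, C q (Function.update j p a q) =
        C p a * ∏ q ∈ Finset.univ.erase p, C q (j q) := by
      intro a
      rw [← Finset.mul_prod_erase _ _ (Finset.mem_univ p)]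
      congr 1
      · simp
      · refine Finset.prod_congr rfl fun q hq => ?_
        rw [Function.update_of_ne (Finset.ne_of_mem_erase hq)]
    have e1 : u p * g * ∏ q, C q (j q) = (1 / 2 : ℝ) •
        (g * ∏ q, C q (Function.update j p a q) + g * ∏ q, C q (Function.update j p b q)) := by
      rw [key, key, ← Finset.mul_prod_erase _ _ (Finset.mem_univ p)]
      calc _ = g * (u p * C p (j p)) * ∏ q ∈ Finset.univ.erase p, C q (j q) := by ring
        _ = _ := by
          rw [hab]; simp only [mul_smul_comm, smul_mul_assoc]; congr 1; ring
    have pos : ∀ a, 0 < a → ∀ q, 0 < Function.update j p a q := by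
      intro a ha q
      by_cases hq : q = p
      · subst hq; simpa using ha
      · rw [Function.update_of_ne hq]; exact hj q
    rw [e1, map_smul, map_add, hg _ (pos a ha), hg _ (pos b hb)]
    simp
  have hBtop : B = ⊤ := by
    rw [← ContinuousMap.subalgebra_topologicalClosure_eq_top_of_separatesPoints B]
    · exact (le_antisymm (B.topologicalClosure_minimal le_rfl hBc)
        B.le_topologicalClosure).symm
    · intro x y hxy
      by_contra hne
      refine hxy (hsep x y fun p => ?_)
      by_contra hp
      exact hne ⟨u p, ⟨u p, hu p, rfl⟩, hp⟩
  have h1 : (1 : C(X, ℝ)) ∈ A := by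
    intro j hj
    rw [one_mul, hT]; exact h j hj
  have hgB : g ∈ B := by rw [hBtop]; trivial
  have := hgB 1 h1 j hj
  rw [mul_one, hT] at this
  exact this

noncomputable def cc (n : ℕ) (t : ℝ) : ℝ := Real.cos (Real.pi * (2 * (n : ℝ) - 1) * t / 2)

theorem cc_cont (n : ℕ) : Continuous (cc n) := by unfold cc; fun_prop

theorem cc_rec (n : ℕ) (hn : 0 < n) : ∃ a b, 0 < a ∧ 0 < b ∧
    ∀ t, Real.cos (Real.pi * t) * cc n t = (1 / 2 : ℝ) * (cc a t + cc b t) := by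
  have key : ∀ x y : ℝ, Real.cos x * Real.cos y = 1 / 2 * (Real.cos (x + y) + Real.cos (y - x)) := by
    intro x y; rw [Real.cos_add, Real.cos_sub]; ring
  rcases Nat.lt_or_ge 1 n with h | h
  · refine ⟨n + 1, n - 1, by omega, by omega, fun t => ?_⟩
    unfold cc
    rw [key, Nat.cast_sub h.le]
    push_cast
    congr 3 <;> ring_nf
  · obtain rfl : n = 1 := by omega
    refine ⟨2, 1, by omega, by omega, fun t => ?_⟩
    unfold cc
    rw [key, ← Real.cos_neg (Real.pi * (2 * ((1 : ℕ) : ℝ) - 1) * t / 2 - _)]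
    push_cast
    congr 3 <;> ring_nf

theorem cube_eq (k : ℕ) : (Set.Icc (0 : Fin k → ℝ) 1) = Set.univ.pi fun _ => Set.Icc (0:ℝ) 1 := by
  ext x; simp [Pi.le_def]

theorem aux_dense (k : ℕ) (F : (Fin k → ℝ) → ℝ) (hF : Integrable F)
    (hsupp : ∀ x, x ∉ Set.Icc (0 : Fin k → ℝ) 1 → F x = 0)
    (h : ∀ j : Fin k → ℕ, (∀ p, 0 < j p) → ∫ x, (∏ p, cc (j p) (x p)) * F x = 0) :
    ∀ᵐ x, F x = 0 := by
  have hK : MeasurableSet (Set.Icc (0 : Fin k → ℝ) 1) := measurableSet_Icc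
  have hsub : ∀ G : (Fin k → ℝ) → ℝ, ∫ x : Set.Icc (0 : Fin k → ℝ) 1, G x * F x
      ∂(Measure.comap Subtype.val volume) = ∫ x, G x * F x := by
    intro G
    rw [integral_subtype_comap hK (fun x => G x * F x)]
    apply setIntegral_eq_integral_of_forall_compl_eq_zero
    intro x hx
    rw [hsupp x hx, mul_zero]
  have hFK : Integrable (fun x : Set.Icc (0 : Fin k → ℝ) 1 => F x)
      (Measure.comap Subtype.val volume) := by
    have := (MeasurableEmbedding.subtype_coe hK).integrableOn_range_iff_comap (f := F) (μ := volume)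
    exact this.1 hF.integrableOn
  have h2 : ∀ g : (Fin k → ℝ) → ℝ, Continuous g →
      ∫ x, g x * ((∏ p, cc 1 (x p)) * F x) = 0 := by
    intro g hg
    have := aux_alg (Measure.comap (Subtype.val : Set.Icc (0 : Fin k → ℝ) 1 → _) volume) k
      (fun p n => ⟨fun x => cc n (x.1 p), (cc_cont n).comp ((continuous_apply p).comp continuous_subtype_val)⟩)
      (fun p => ⟨fun x => Real.cos (Real.pi * x.1 p), Real.continuous_cos.comp
        (continuous_const.mul ((continuous_apply p).comp continuous_subtype_val))⟩)
      (fun x => F x) hFK ?_ ?_ ?_ ⟨fun x => g x.1, hg.comp continuous_subtype_val⟩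
      (fun _ => 1) (fun _ => one_pos)
    · rw [← this]
      simp only [← mul_assoc]
      rw [← hsub (fun x => g x * ∏ p, cc 1 (x p))]
      simp [ContinuousMap.prod_apply]
    · intro j hj
      rw [← h j hj, ← hsub]
      simp [ContinuousMap.prod_apply]
    · intro p j hj
      obtain ⟨a, b, ha, hb, hab⟩ := cc_rec j hj
      refine ⟨a, b, ha, hb, ?_⟩
      ext x
      simpa [mul_add] using hab (x.1 p)
    · intro x y hxy
      ext p
      have := hxy p
      simp only [ContinuousMap.coe_mk] at this
      have hx := x.2; have hy := y.2
      have hpi := Real.pi_pos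
      have := Real.injOn_cos ⟨mul_nonneg hpi.le (hx.1 p), mul_le_of_le_one_right hpi.le (hx.2 p)⟩
        ⟨mul_nonneg hpi.le (hy.1 p), mul_le_of_le_one_right hpi.le (hy.2 p)⟩ this
      exact mul_left_cancel₀ hpi.ne' this
  have hcont : Continuous fun x : Fin k → ℝ => ∏ p, cc 1 (x p) :=
    continuous_finsetProd _ fun p _ => (cc_cont 1).comp (continuous_apply p)
  have hint : Integrable fun x : Fin k → ℝ => (∏ p, cc 1 (x p)) * F x := by
    refine hF.bdd_mul hcont.aestronglyMeasurable (c := 1) (Filter.Eventually.of_forall fun x => ?_)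
    rw [norm_prod]
    refine Finset.prod_le_one (fun _ _ => norm_nonneg _) fun p _ => ?_
    exact Real.abs_cos_le_one _
  have h3 := ae_eq_zero_of_integral_contDiff_smul_eq_zero hint.locallyIntegrable
    (fun g hg _ => by simpa using h2 g hg.continuous)
  have h4 : ∀ᵐ x : Fin k → ℝ, ∀ p, x p ≠ 1 := by
    rw [ae_all_iff]
    intro p
    have := Measure.pi_hyperplane (fun _ : Fin k => (volume : Measure ℝ)) p 1
    rw [← volume_pi, measure_eq_zero_iff_ae_notMem] at this
    filter_upwards [this] with x hx he
    exact hx he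
  filter_upwards [h3, h4] with x hx hx1
  by_cases hxK : x ∈ Set.Icc (0 : Fin k → ℝ) 1
  · refine (mul_eq_zero.1 hx).resolve_left ?_
    refine Finset.prod_ne_zero_iff.2 fun p _ => ?_
    have a1 : 0 ≤ x p := hxK.1 p
    have a2 : x p < 1 := lt_of_le_of_ne (hxK.2 p) (hx1 p)
    have hpi := Real.pi_pos
    refine (Real.cos_pos_of_mem_Ioo ⟨?_, ?_⟩).ne'
    · push_cast; nlinarith
    · push_cast; nlinarith
  · exact hsupp x hxK

noncomputable def DD (k : ℕ) (jj : Fin k → ℕ) (x : Fin k → ℝ) : ℝ :=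
  Matrix.det (Matrix.of fun p q : Fin k => cc (jj p) (x q))

theorem phi_eq (k : ℕ) (jj : Fin k → ℕ) (x : Fin k → ℝ) :
    phiCos k jj x = Real.sqrt 2 ^ k * DD k jj x := rfl

theorem DD1 (k : ℕ) (jj : Fin k → ℕ) (x : Fin k → ℝ) :
    DD k jj x = ∑ σ : Equiv.Perm (Fin k), ((Equiv.Perm.sign σ : ℤ) : ℝ) *
      ∏ i, cc (jj (σ i)) (x i) := by
  unfold DD; rw [Matrix.det_apply']; rfl

theorem DD2 (k : ℕ) (jj : Fin k → ℕ) (x : Fin k → ℝ) :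
    DD k jj x = ∑ σ : Equiv.Perm (Fin k), ((Equiv.Perm.sign σ : ℤ) : ℝ) *
      ∏ i, cc (jj i) (x (σ i)) := by
  unfold DD; rw [← Matrix.det_transpose, Matrix.det_apply']; rfl

theorem DDperm1 (k : ℕ) (jj : Fin k → ℕ) (x : Fin k → ℝ) (σ : Equiv.Perm (Fin k)) :
    DD k (jj ∘ σ) x = ((Equiv.Perm.sign σ : ℤ) : ℝ) * DD k jj x :=
  Matrix.det_permute σ (Matrix.of fun p q : Fin k => cc (jj p) (x q))

theorem DDperm2 (k : ℕ) (jj : Fin k → ℕ) (x : Fin k → ℝ) (σ : Equiv.Perm (Fin k)) :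
    DD k jj (x ∘ σ) = ((Equiv.Perm.sign σ : ℤ) : ℝ) * DD k jj x :=
  Matrix.det_permute' σ (Matrix.of fun p q : Fin k => cc (jj p) (x q))

theorem DD_cont (k : ℕ) (jj : Fin k → ℕ) : Continuous (DD k jj) := by
  unfold DD
  refine Continuous.matrix_det (continuous_matrix fun p q => ?_)
  exact (cc_cont _).comp (continuous_apply q)

theorem DD_zero (k : ℕ) (jj : Fin k → ℕ) (x : Fin k → ℝ) (h : ¬ Function.Injective jj) :
    DD k jj x = 0 := by
  simp only [Function.Injective, not_forall] at h
  obtain ⟨a, b, hab, hne⟩ := h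
  refine Matrix.det_zero_of_row_eq hne ?_
  ext q; simp [hab]

theorem sort_dec (k : ℕ) (n : Fin k → ℕ) (hn : Function.Injective n) :
    ∃ σ : Equiv.Perm (Fin k), ∀ p q : Fin k, p < q → (n ∘ σ) q < (n ∘ σ) p := by
  refine ⟨Tuple.sort (OrderDual.toDual ∘ n), fun p q hpq => ?_⟩
  have h := Tuple.monotone_sort (OrderDual.toDual ∘ n)
  have h1 : (n ∘ (Tuple.sort (OrderDual.toDual ∘ n))) q ≤ (n ∘ (Tuple.sort (OrderDual.toDual ∘ n))) p :=
    h hpq.le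
  refine lt_of_le_of_ne h1 fun he => hpq.ne' ?_
  exact (Tuple.sort (OrderDual.toDual ∘ n)).injective (hn he)

noncomputable def pe (k : ℕ) (σ : Equiv.Perm (Fin k)) : (Fin k → ℝ) ≃ᵐ (Fin k → ℝ) :=
  MeasurableEquiv.arrowCongr' σ.symm (MeasurableEquiv.refl ℝ)

theorem pe_apply (k : ℕ) (σ : Equiv.Perm (Fin k)) (x : Fin k → ℝ) : pe k σ x = x ∘ σ := rfl

theorem pe_mp (k : ℕ) (σ : Equiv.Perm (Fin k)) : MeasurePreserving (pe k σ) volume volume :=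
  volume_preserving_arrowCongr' _ _ (MeasurePreserving.id _)

theorem ae_inj (k : ℕ) : ∀ᵐ x : Fin k → ℝ, Function.Injective x := by
  have : ∀ᵐ x : Fin k → ℝ, ∀ i j : Fin k, i ≠ j → x i ≠ x j := by
    rw [ae_all_iff]; intro i
    rw [ae_all_iff]; intro j
    by_cases hij : i = j
    · simp [hij]
    let S : Submodule ℝ (Fin k → ℝ) := LinearMap.ker
      (LinearMap.proj (R := ℝ) (φ := fun _ : Fin k => ℝ) i - LinearMap.proj j)
    have hS : S ≠ ⊤ := by
      intro h
      have h1 : (Pi.single i 1 : Fin k → ℝ) ∈ S := by rw [h]; trivial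
      simp [S, Pi.single_apply, Ne.symm hij] at h1
    have := Measure.addHaar_submodule (volume : Measure (Fin k → ℝ)) S hS
    rw [measure_eq_zero_iff_ae_notMem] at this
    filter_upwards [this] with x hx _ he
    apply hx
    simp [S, he]
  filter_upwards [this] with x hx i j hij
  by_contra hne
  exact hx i j hne hij

theorem simplex_eq (k : ℕ) : orderSimplex k = Set.Icc (0 : Fin k → ℝ) 1 ∩ {x | Monotone x} := by
  ext x; simp [orderSimplex, Pi.le_def, forall_and]

theorem simplex_sub (k : ℕ) : orderSimplex k ⊆ Set.Icc (0 : Fin k → ℝ) 1 := by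
  rw [simplex_eq]; exact Set.inter_subset_left

theorem simplex_meas (k : ℕ) : MeasurableSet (orderSimplex k) := by
  rw [simplex_eq]
  refine measurableSet_Icc.inter ?_
  have : {x : Fin k → ℝ | Monotone x} = ⋂ i, ⋂ j, ⋂ _ : i ≤ j, {x | x i ≤ x j} := by
    ext x; simp [Monotone]
  rw [this]
  refine MeasurableSet.iInter fun i => MeasurableSet.iInter fun j => MeasurableSet.iInter fun _ => ?_
  exact measurableSet_le (measurable_pi_apply i) (measurable_pi_apply j)

theorem cube_perm (k : ℕ) (x : Fin k → ℝ) (σ : Equiv.Perm (Fin k)) :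
    x ∘ σ ∈ Set.Icc (0 : Fin k → ℝ) 1 ↔ x ∈ Set.Icc (0 : Fin k → ℝ) 1 := by
  simp only [Set.mem_Icc, Pi.le_def, Function.comp_apply, Pi.zero_apply, Pi.one_apply]
  rw [σ.forall_congr_right (q := fun i => 0 ≤ x i), σ.forall_congr_right (q := fun i => x i ≤ 1)]

theorem simplex_perm (k : ℕ) (x : Fin k → ℝ) (hx : Function.Injective x)
    (hxK : x ∈ Set.Icc (0 : Fin k → ℝ) 1) (σ : Equiv.Perm (Fin k)) :
    x ∘ σ ∈ orderSimplex k ↔ σ = Tuple.sort x := by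
  rw [simplex_eq, Set.mem_inter_iff, cube_perm]
  simp only [hxK, true_and, Set.mem_setOf_eq]
  rw [← Tuple.comp_sort_eq_comp_iff_monotone]
  constructor
  · intro h
    ext i
    exact congrArg _ (hx (congrFun h i))
  · rintro rfl; rfl

theorem ind_sum (k : ℕ) (x : Fin k → ℝ) (hx : Function.Injective x) :
    ∑ σ : Equiv.Perm (Fin k), (orderSimplex k).indicator (fun _ => (1 : ℝ)) (x ∘ σ) =
      (Set.Icc (0 : Fin k → ℝ) 1).indicator (fun _ => (1 : ℝ)) x := by
  classical
  by_cases hxK : x ∈ Set.Icc (0 : Fin k → ℝ) 1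
  · simp only [Set.indicator_apply, simplex_perm k x hx hxK]
    rw [if_pos hxK]
    simp
  · rw [Set.indicator_of_notMem hxK]
    refine Finset.sum_eq_zero fun σ _ => Set.indicator_of_notMem (fun h => hxK ?_) _
    exact (cube_perm k x σ).1 (simplex_sub k h)

theorem sign_sq (k : ℕ) (σ : Equiv.Perm (Fin k)) :
    ((Equiv.Perm.sign σ : ℤ) : ℝ) * ((Equiv.Perm.sign σ : ℤ) : ℝ) = 1 := by
  rw [← Int.cast_mul, Int.units_coe_mul_self]; simp

theorem cos_int (m : ℤ) (hm : m ≠ 0) : ∫ t in (0:ℝ)..1, Real.cos (Real.pi * m * t) = 0 := by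
  have h : Real.pi * (m : ℝ) ≠ 0 := mul_ne_zero Real.pi_ne_zero (by exact_mod_cast hm)
  rw [intervalIntegral.integral_comp_mul_left (fun t => Real.cos t) h]
  simp [mul_comm Real.pi, Real.sin_int_mul_pi]

theorem cc_orth (a b : ℕ) (ha : 0 < a) (hb : 0 < b) :
    ∫ t in Set.Icc (0:ℝ) 1, cc a t * cc b t = if a = b then 1 / 2 else 0 := by
  rw [integral_Icc_eq_integral_Ioc, ← intervalIntegral.integral_of_le zero_le_one]
  have e : ∀ t, cc a t * cc b t = 1 / 2 * Real.cos (Real.pi * ((a - b : ℤ) : ℝ) * t) +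
      1 / 2 * Real.cos (Real.pi * ((a + b - 1 : ℤ) : ℝ) * t) := by
    intro t
    have key : ∀ x y : ℝ, Real.cos x * Real.cos y =
        1 / 2 * Real.cos (x - y) + 1 / 2 * Real.cos (x + y) := by
      intro x y; rw [Real.cos_add, Real.cos_sub]; ring
    unfold cc
    rw [key]
    push_cast
    congr 3 <;> ring
  simp only [e]
  rw [intervalIntegral.integral_add (Continuous.intervalIntegrable (by fun_prop) _ _)
    (Continuous.intervalIntegrable (by fun_prop) _ _), intervalIntegral.integral_const_mul,
    intervalIntegral.integral_const_mul, cos_int (a + b - 1) (by omega)]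
  split_ifs with h
  · simp [h]
  · rw [cos_int _ (by omega)]; simp

theorem prod_orth (k : ℕ) (a b : Fin k → ℕ) (ha : ∀ p, 0 < a p) (hb : ∀ p, 0 < b p) :
    ∫ x in Set.Icc (0 : Fin k → ℝ) 1, (∏ p, cc (a p) (x p)) * ∏ p, cc (b p) (x p) =
      if a = b then (1 / 2) ^ k else 0 := by
  simp only [← Finset.prod_mul_distrib]
  rw [cube_eq, volume_pi, Measure.restrict_pi_pi,
    integral_fintype_prod_eq_prod (fun p t => cc (a p) t * cc (b p) t)]
  simp only [cc_orth _ _ (ha _) (hb _)]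
  split_ifs with h
  · simp [h]
  · obtain ⟨p, hp⟩ := Function.ne_iff.1 h
    exact Finset.prod_eq_zero (Finset.mem_univ p) (if_neg hp)

theorem DD_orth (k : ℕ) (a b : Fin k → ℕ) (ha : ∀ p, 0 < a p) (hb : ∀ p, 0 < b p)
    (ha' : ∀ p q : Fin k, p < q → a q < a p) (hb' : ∀ p q : Fin k, p < q → b q < b p) :
    ∫ x in orderSimplex k, DD k a x * DD k b x = if a = b then (1 / 2) ^ k else 0 := by
  have hC : ∀ b : Fin k → ℕ, Continuous fun x : Fin k → ℝ => ∏ p, cc (b p) (x p) := fun b =>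
    continuous_finsetProd _ fun p _ => (cc_cont _).comp (continuous_apply p)
  have hK : IsCompact (Set.Icc (0 : Fin k → ℝ) 1) := isCompact_Icc
  set H : (Fin k → ℝ) → ℝ := fun x => DD k a x * ∏ p, cc (b p) (x p) with hH
  have hHc : Continuous H := (DD_cont k a).mul (hC b)
  have hHi : Integrable ((orderSimplex k).indicator H) := by
    rw [integrable_indicator_iff (simplex_meas k)]
    exact (hHc.continuousOn.integrableOn_compact hK).mono_set (simplex_sub k)
  have e1 : ∀ x, (orderSimplex k).indicator (fun x => DD k a x * DD k b x) x =
      ∑ σ : Equiv.Perm (Fin k), (orderSimplex k).indicator (fun x => H (x ∘ σ)) x := by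
    intro x
    by_cases hx : x ∈ orderSimplex k
    · simp only [Set.indicator_of_mem hx]
      rw [DD2 k b, Finset.mul_sum]
      refine Finset.sum_congr rfl fun σ _ => ?_
      simp only [hH, DDperm2, Function.comp_apply]
      ring
    · simp only [Set.indicator_of_notMem hx, Finset.sum_const_zero]
  have e2 : ∀ σ : Equiv.Perm (Fin k), ∀ x,
      (orderSimplex k).indicator (fun x => H (x ∘ σ)) x =
        (fun y => (orderSimplex k).indicator (fun _ => (1:ℝ)) (y ∘ σ.symm) * H y) (pe k σ x) := by
    intro σ x
    have : (x ∘ σ) ∘ σ.symm = x := by ext i; simp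
    simp only [pe_apply, this]
    by_cases hx : x ∈ orderSimplex k
    · simp [Set.indicator_of_mem hx]
    · simp [Set.indicator_of_notMem hx]
  have i1 : ∀ σ : Equiv.Perm (Fin k),
      Integrable ((orderSimplex k).indicator (fun x => H (x ∘ σ))) := by
    intro σ
    rw [integrable_indicator_iff (simplex_meas k)]
    have : Continuous fun x : Fin k → ℝ => H (x ∘ σ) :=
      hHc.comp (continuous_pi fun i => continuous_apply (σ i))
    exact (this.continuousOn.integrableOn_compact hK).mono_set (simplex_sub k)
  have i2 : ∀ σ : Equiv.Perm (Fin k), Integrable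
      (fun y => (orderSimplex k).indicator (fun _ => (1:ℝ)) (y ∘ σ.symm) * H y) := by
    intro σ
    rw [← (pe_mp k σ).integrable_comp_emb (pe k σ).measurableEmbedding]
    have := i1 σ
    rw [funext (e2 σ)] at this
    exact this
  rw [← integral_indicator (simplex_meas k)]
  simp only [e1]
  rw [integral_finsetSum _ fun σ _ => i1 σ]
  simp only [e2]
  simp only [fun σ => (pe_mp k σ).integral_comp'
    (fun y => (orderSimplex k).indicator (fun _ => (1:ℝ)) (y ∘ σ.symm) * H y)]
  rw [← integral_finsetSum _ fun σ _ => i2 σ]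
  have e3 : (fun y => ∑ σ : Equiv.Perm (Fin k),
      (orderSimplex k).indicator (fun _ => (1:ℝ)) (y ∘ σ.symm) * H y) =ᵐ[volume]
      (Set.Icc (0 : Fin k → ℝ) 1).indicator H := by
    filter_upwards [ae_inj k] with y hy
    have e4 := Equiv.sum_comp (Equiv.inv (Equiv.Perm (Fin k)))
      (fun σ => (orderSimplex k).indicator (fun _ => (1:ℝ)) (y ∘ σ))
    rw [ind_sum k y hy] at e4
    rw [← Finset.sum_mul]
    refine (congrArg (· * H y) e4).trans ?_
    by_cases hyK : y ∈ Set.Icc (0 : Fin k → ℝ) 1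
    · simp [Set.indicator_of_mem hyK]
    · simp [Set.indicator_of_notMem hyK]
  rw [integral_congr_ae e3, integral_indicator measurableSet_Icc]
  simp only [hH, DD1, Finset.sum_mul, mul_assoc]
  rw [integral_finsetSum]
  · simp only [integral_const_mul]
    have : ∀ σ : Equiv.Perm (Fin k), ∫ x in Set.Icc (0 : Fin k → ℝ) 1,
        (∏ p, cc (a (σ p)) (x p)) * ∏ p, cc (b p) (x p) =
        if σ = 1 then (if a = b then (1 / 2) ^ k else 0) else 0 := by
      intro σ
      rw [prod_orth k (fun p => a (σ p)) b (fun p => ha _) hb]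
      by_cases hσ : σ = 1
      · simp [hσ]
      · rw [if_neg hσ, if_neg]
        intro h
        apply hσ
        have sa : StrictMono (OrderDual.toDual ∘ a) := fun p q hpq => ha' p q hpq
        have m1 : Monotone ((OrderDual.toDual ∘ a) ∘ (1 : Equiv.Perm (Fin k))) := sa.monotone
        have m2 : Monotone ((OrderDual.toDual ∘ a) ∘ σ) := by
          have sb : StrictMono (OrderDual.toDual ∘ b) := fun p q hpq => hb' p q hpq
          rw [← h] at sb
          exact sb.monotone
        have := Tuple.unique_monotone m1 m2
        ext i
        exact congrArg _ (sa.injective (congrFun this i)).symm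
    simp only [this]
    simp
  · intro σ _
    exact ((((hC (fun p => a (σ p))).mul (hC b)).const_mul _).continuousOn.integrableOn_compact hK)

theorem DD_complete (k : ℕ) (f : (Fin k → ℝ) → ℝ) (hf : IntegrableOn f (orderSimplex k))
    (h : ∀ j : Fin k → ℕ, (∀ p q : Fin k, p < q → j q < j p) → (∀ p, 0 < j p) →
      ∫ x in orderSimplex k, DD k j x * f x = 0) :
    ∀ᵐ x ∂(volume.restrict (orderSimplex k)), f x = 0 := by
  have h' : ∀ j : Fin k → ℕ, (∀ p, 0 < j p) → ∫ x in orderSimplex k, DD k j x * f x = 0 := by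
    intro j hj
    by_cases hinj : Function.Injective j
    · obtain ⟨σ, hσ⟩ := sort_dec k j hinj
      have := h (j ∘ σ) hσ (fun p => hj _)
      simp only [DDperm1, mul_assoc] at this
      rw [integral_const_mul] at this
      refine (mul_eq_zero.1 this).resolve_left fun h0 => ?_
      have := sign_sq k σ
      rw [h0] at this; simp at this
    · simp [DD_zero k j _ hinj]
  set f' := (orderSimplex k).indicator f with hf'
  have hf'i : Integrable f' := (integrable_indicator_iff (simplex_meas k)).2 hf
  set F : (Fin k → ℝ) → ℝ := fun x => ∑ σ : Equiv.Perm (Fin k),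
    ((Equiv.Perm.sign σ : ℤ) : ℝ) * f' (x ∘ σ) with hF
  have hi : ∀ σ : Equiv.Perm (Fin k), Integrable (fun x => f' (x ∘ σ)) := fun σ =>
    ((pe_mp k σ).integrable_comp_emb (pe k σ).measurableEmbedding).2 hf'i
  have hFi : Integrable F := integrable_finsetSum _ fun σ _ => (hi σ).const_mul _
  have hb : ∀ (j : Fin k → ℕ) (τ : Fin k → Fin k) (g : (Fin k → ℝ) → ℝ), Integrable g →
      Integrable fun x => (∏ p, cc (j p) (x (τ p))) * g x := by
    intro j τ g hg
    have hcont : Continuous fun x : Fin k → ℝ => ∏ p, cc (j p) (x (τ p)) :=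
      continuous_finsetProd _ fun p _ => (cc_cont _).comp (continuous_apply _)
    refine hg.bdd_mul hcont.aestronglyMeasurable (c := 1) (Filter.Eventually.of_forall fun x => ?_)
    rw [norm_prod]
    refine Finset.prod_le_one (fun _ _ => norm_nonneg _) fun p _ => ?_
    exact Real.abs_cos_le_one _
  have hF0 := aux_dense k F hFi ?_ ?_
  · rw [ae_restrict_iff' (simplex_meas k)]
    filter_upwards [hF0, ae_inj k] with x hx hinj hxO
    have hs : ∀ σ : Equiv.Perm (Fin k), x ∘ σ ∈ orderSimplex k ↔ σ = 1 := by
      intro σ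
      have s := simplex_perm k x hinj (simplex_sub k hxO)
      rw [s, ← (s 1).1 (by simpa using hxO)]
    rw [hF] at hx
    simp only at hx
    rw [Finset.sum_eq_single 1] at hx
    · simpa [hf', Set.indicator_of_mem hxO] using hx
    · intro σ _ hσ
      rw [hf', Set.indicator_of_notMem (fun h => hσ ((hs σ).1 h)), mul_zero]
    · simp
  · intro x hx
    refine Finset.sum_eq_zero fun σ _ => ?_
    rw [hf', Set.indicator_of_notMem, mul_zero]
    exact fun h => hx ((cube_perm k x σ).1 (simplex_sub k h))
  · intro j hj
    simp only [hF, Finset.mul_sum]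
    have e : ∀ σ : Equiv.Perm (Fin k), ∀ x : Fin k → ℝ, (∏ p, cc (j p) (x p)) *
        (((Equiv.Perm.sign σ : ℤ) : ℝ) * f' (x ∘ σ)) =
        (fun y => ((Equiv.Perm.sign σ : ℤ) : ℝ) *
          ((∏ p, cc (j p) (y (σ.symm p))) * f' y)) (pe k σ x) := by
      intro σ x
      simp only [pe_apply, Function.comp_apply, Equiv.apply_symm_apply]
      ring
    rw [integral_finsetSum]
    · simp only [e]
      simp only [fun σ => (pe_mp k σ).integral_comp' (fun y => ((Equiv.Perm.sign σ : ℤ) : ℝ) *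
          ((∏ p, cc (j p) (y (σ.symm p))) * f' y))]
      rw [← integral_finsetSum _ fun σ _ => (hb j _ f' hf'i).const_mul _]
      rw [← h' j hj, ← integral_indicator (simplex_meas k)]
      congr 1
      ext y
      have : (orderSimplex k).indicator (fun x => DD k j x * f x) y = DD k j y * f' y := by
        by_cases hy : y ∈ orderSimplex k
        · simp [hf', Set.indicator_of_mem hy]
        · simp [hf', Set.indicator_of_notMem hy]
      rw [this, DD2, Finset.sum_mul, ← Equiv.sum_comp (Equiv.inv (Equiv.Perm (Fin k)))]
      refine Finset.sum_congr rfl fun σ _ => ?_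
      have e5 : Equiv.symm (σ⁻¹) = σ := rfl
      simp [mul_assoc, e5]
    · intro σ _
      simpa only [mul_left_comm, id] using (hb j id _ (hi σ)).const_mul ((Equiv.Perm.sign σ : ℤ) : ℝ)

end aux

theorem cos_eigensystem_complete (k : ℕ) (hk : 1 ≤ k)
    (e : {jj : Fin k → ℕ // (∀ p q : Fin k, p < q → jj q < jj p) ∧ ∀ p, 0 < jj p} →
      Lp ℝ 2 (volume.restrict (orderSimplex k)))
    (he : ∀ jj, (e jj : (Fin k → ℝ) → ℝ)
        =ᵐ[volume.restrict (orderSimplex k)] phiCos k jj.1) :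
    Orthonormal ℝ e ∧ (Submodule.span ℝ (Set.range e)).topologicalClosure = ⊤ := by
  classical
  have hs : Real.sqrt 2 ^ k ≠ 0 := pow_ne_zero _ (by positivity)
  constructor
  · rw [orthonormal_iff_ite]
    intro a b
    rw [L2.inner_def]
    have : ∀ᵐ x ∂(volume.restrict (orderSimplex k)), inner ℝ (e a x) (e b x) =
        2 ^ k * (DD k a.1 x * DD k b.1 x) := by
      filter_upwards [he a, he b] with x h1 h2
      rw [h1, h2, phi_eq, phi_eq]
      simp only [inner, conj_trivial]
      have : Real.sqrt 2 ^ k * Real.sqrt 2 ^ k = 2 ^ k := by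
        rw [← mul_pow, Real.mul_self_sqrt (by norm_num)]
      rw [← this]
      simp
      ring
    rw [integral_congr_ae this, integral_const_mul,
      DD_orth k a.1 b.1 a.2.2 b.2.2 a.2.1 b.2.1]
    simp only [Subtype.ext_iff]
    split_ifs
    · rw [← mul_pow]; norm_num
    · simp
  · rw [Submodule.topologicalClosure_eq_top_iff, Submodule.eq_bot_iff]
    intro f hf
    haveI : IsFiniteMeasure (volume.restrict (orderSimplex k)) := by
      refine ⟨?_⟩
      rw [Measure.restrict_apply_univ]
      exact (measure_mono (simplex_sub k)).trans_lt isCompact_Icc.measure_lt_top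
    have hfi : IntegrableOn f (orderSimplex k) := (Lp.memLp f).integrable one_le_two
    rw [Lp.eq_zero_iff_ae_eq_zero]
    refine DD_complete k f hfi fun j hj1 hj2 => ?_
    have h1 := (Submodule.mem_orthogonal _ f).1 hf (e ⟨j, hj1, hj2⟩)
      (Submodule.subset_span ⟨_, rfl⟩)
    rw [L2.inner_def] at h1
    have : ∀ᵐ x ∂(volume.restrict (orderSimplex k)), inner ℝ (e ⟨j, hj1, hj2⟩ x) (f x) =
        Real.sqrt 2 ^ k * (DD k j x * f x) := by
      filter_upwards [he ⟨j, hj1, hj2⟩] with x h1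
      rw [h1, phi_eq]
      simp [inner]
      ring
    rw [integral_congr_ae this, integral_const_mul] at h1
    exact (mul_eq_zero.1 h1).resolve_left hs
end

section
/- For every integer n ≥ 1, A_n = (2^{n+2} · n! / π^{n+1}) · Σ_{k=1}^∞ (−1)^{(k−1)(n−1)} / (2k−1)^{n+1}, where A_n is the number of up-down permutations of n elements and the series on the right converges. -/
open MeasureTheory

def UD {j : ℕ} (σ : Equiv.Perm (Fin j)) : Prop :=
  ∀ i : Fin j, ∀ h : (i : ℕ) + 1 < j,
      if (i : ℕ) % 2 = 0 then σ i < σ ⟨(i : ℕ) + 1, h⟩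
      else σ ⟨(i : ℕ) + 1, h⟩ < σ i

open Classical in
noncomputable def EN (n k : ℕ) : ℕ :=
  (Finset.univ.filter (fun σ : Equiv.Perm (Fin (n+1)) => UD σ ∧ (σ 0 : ℕ) = k)).card

theorem insFun_inj {n : ℕ} (k : Fin (n+2)) (τ : Equiv.Perm (Fin (n+1))) :
    Function.Injective (Fin.cons k (fun i => k.succAbove (Fin.rev (τ i))) : Fin (n+2) → Fin (n+2)) := by
  rw [Fin.cons_injective_iff]
  constructor
  · rintro ⟨i, hi⟩
    exact Fin.succAbove_ne _ _ hi
  · intro a b h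
    simpa using h

noncomputable def ins {n : ℕ} (k : Fin (n+2)) (τ : Equiv.Perm (Fin (n+1))) : Equiv.Perm (Fin (n+2)) :=
  Equiv.ofBijective _ (Finite.injective_iff_bijective.mp (insFun_inj k τ))

theorem ins_zero {n : ℕ} (k : Fin (n+2)) (τ : Equiv.Perm (Fin (n+1))) : ins k τ 0 = k := rfl
theorem ins_succ {n : ℕ} (k : Fin (n+2)) (τ : Equiv.Perm (Fin (n+1))) (i : Fin (n+1)) :
    ins k τ i.succ = k.succAbove (Fin.rev (τ i)) := rfl

theorem ins_UD {n : ℕ} (k : Fin (n+2)) (τ : Equiv.Perm (Fin (n+1))) :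
    UD (ins k τ) ↔ UD τ ∧ (τ 0 : ℕ) < n + 1 - k := by
  have h0 : ins k τ 0 < ins k τ (Fin.succ 0) ↔ (τ 0 : ℕ) < n + 1 - k := by
    rw [ins_zero, ins_succ, Fin.lt_succAbove_iff_le_castSucc, Fin.le_def]
    have := (τ 0).2
    simp only [Fin.val_castSucc, Fin.val_rev]
    omega
  have hs : ∀ i j : Fin (n+1), ins k τ i.succ < ins k τ j.succ ↔ τ j < τ i := by
    intro i j
    rw [ins_succ, ins_succ, (Fin.strictMono_succAbove k).lt_iff_lt, Fin.rev_lt_rev]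
  constructor
  · intro H
    refine ⟨?_, ?_⟩
    · intro i h
      have := H i.succ (by simp; omega)
      have e : (⟨(i.succ : ℕ) + 1, by simp; omega⟩ : Fin (n+2)) = Fin.succ ⟨i+1, h⟩ := by
        ext; simp
      rw [e, hs, hs] at this
      simp only [Fin.val_succ] at this
      split_ifs at this ⊢ <;> omega
    · have := H 0 (by simp)
      rw [← h0]
      simpa using this
  · rintro ⟨H, h1⟩ i h
    induction i using Fin.cases with
    | zero => simpa using h0.mpr h1
    | succ i =>
      have h' : (i:ℕ) + 1 < n + 1 := by simp at h; omega
      have := H i h'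
      have e : (⟨(i.succ : ℕ) + 1, h⟩ : Fin (n+2)) = Fin.succ ⟨i+1, h'⟩ := by
        ext; simp
      rw [e, hs, hs]
      simp only [Fin.val_succ]
      split_ifs at this ⊢ <;> omega

theorem ins_surj {n : ℕ} (σ : Equiv.Perm (Fin (n+2))) : ∃ τ, ins (σ 0) τ = σ := by
  have h : ∀ i : Fin (n+1), ∃ j, (σ 0).succAbove j = σ i.succ := by
    intro i
    apply Fin.exists_succAbove_eq
    intro h
    exact Fin.succ_ne_zero _ (σ.injective h)
  choose f hf using h
  have hinj : Function.Injective (fun i => Fin.rev (f i)) := by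
    intro a b hab
    have : f a = f b := by simpa using hab
    have h2 : σ a.succ = σ b.succ := by rw [← hf, ← hf, this]
    simpa using h2
  refine ⟨Equiv.ofBijective _ (Finite.injective_iff_bijective.mp hinj), ?_⟩
  ext i
  induction i using Fin.cases with
  | zero => rw [ins_zero]
  | succ i => rw [ins_succ]; simp [hf]

theorem ins_inj {n : ℕ} (k : Fin (n+2)) {τ τ' : Equiv.Perm (Fin (n+1))} (h : ins k τ = ins k τ') : τ = τ' := by
  ext i
  have : ins k τ i.succ = ins k τ' i.succ := by rw [h]
  rw [ins_succ, ins_succ] at this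
  have := Fin.succAbove_right_injective this
  rw [Fin.rev_injective this]

open Classical in
theorem sum_EN (n m : ℕ) : ∑ i ∈ Finset.range m, EN n i =
    (Finset.univ.filter (fun σ : Equiv.Perm (Fin (n+1)) => UD σ ∧ (σ 0 : ℕ) < m)).card := by
  rw [Finset.card_eq_sum_card_fiberwise (f := fun σ : Equiv.Perm (Fin (n+1)) => (σ 0 : ℕ)) (t := Finset.range m)]
  · apply Finset.sum_congr rfl
    intro i hi
    rw [EN, Finset.filter_filter]
    congr 1
    ext σ
    simp at hi ⊢
    grind
  · intro σ
    simp

open Classical in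
theorem EN_succ (n k : ℕ) (hk : k ≤ n + 1) : EN (n+1) k = ∑ i ∈ Finset.range (n + 1 - k), EN n i := by
  rw [sum_EN, EN]
  symm
  refine Finset.card_bij (fun τ _ => ins ⟨k, by omega⟩ τ) ?_ ?_ ?_
  · intro τ hτ
    simp only [Finset.mem_filter, Finset.mem_univ, true_and] at hτ ⊢
    exact ⟨(ins_UD _ _).mpr hτ, by rw [ins_zero]⟩
  · intro a _ b _ h
    exact ins_inj _ h
  · intro σ hσ
    simp only [Finset.mem_filter, Finset.mem_univ, true_and] at hσ
    obtain ⟨τ, hτ⟩ := ins_surj σ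
    have e : σ 0 = ⟨k, by omega⟩ := Fin.ext hσ.2
    rw [e] at hτ
    refine ⟨τ, ?_, hτ⟩
    simp only [Finset.mem_filter, Finset.mem_univ, true_and]
    have := (ins_UD ⟨k, by omega⟩ τ).mp (hτ ▸ hσ.1)
    exact this

theorem EN_zero : EN 0 0 = 1 := by
  classical
  rw [EN, Finset.filter_true_of_mem]
  · simp
  · intro σ _
    exact ⟨fun i h => by omega, by simp⟩

theorem updown_eq (n : ℕ) : updownCount (n+1) = EN (n+1) 0 := by
  classical
  rw [EN_succ _ _ (by omega), sum_EN]
  rw [updownCount, Nat.card_eq_fintype_card, Fintype.card_subtype]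
  refine congrArg Finset.card (Finset.filter_congr fun σ _ => ?_)
  exact ⟨fun h => ⟨h, (σ 0).2⟩, fun h => h.1⟩

theorem EN_diff (n k : ℕ) (hk : k ≤ n) : EN (n+1) k = EN (n+1) (k+1) + EN n (n - k) := by
  rw [EN_succ _ _ (by omega), EN_succ _ _ (by omega)]
  have e1 : n + 1 - k = (n - k) + 1 := by omega
  have e2 : n + 1 - (k + 1) = n - k := by omega
  rw [e1, e2, Finset.sum_range_succ]

theorem EN_last (n : ℕ) : EN (n+1) (n+1) = 0 := by
  rw [EN_succ _ _ (by omega)]; simp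

open Polynomial in
noncomputable def Q (n : ℕ) : ℝ[X] := ∑ k ∈ Finset.range (n+1), (EN n k : ℝ[X]) * bernsteinPolynomial ℝ n k

theorem Q_zero (n : ℕ) : (Q n).eval 0 = EN n 0 := by
  simp [Q, Polynomial.eval_finsetSum, bernsteinPolynomial.eval_at_0]

theorem Q_one (n : ℕ) : (Q (n+1)).eval 1 = 0 := by
  simp only [Q, Polynomial.eval_finsetSum, Polynomial.eval_mul, bernsteinPolynomial.eval_at_1]
  simp [EN_last]

theorem Q_first (x : ℝ) : (Q 1).eval x = 1 - x := by
  have h1 : EN 1 0 = 1 := by rw [EN_succ _ _ (by omega)]; simp [EN_zero]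
  simp [Q, Finset.sum_range_succ, EN_last, h1, bernsteinPolynomial]

open Polynomial in
theorem Q_deriv (n : ℕ) : derivative (Q (n+1)) = -((n:ℝ[X])+1) * (Q n).comp (1 - X) := by
  have h1 : (Q n).comp (1 - X) = ∑ k ∈ Finset.range (n+1), (EN n (n-k) : ℝ[X]) * bernsteinPolynomial ℝ n k := by
    rw [Q, ← Finset.sum_range_reflect]
    simp only [Polynomial.sum_comp]
    apply Finset.sum_congr rfl
    intro k hk
    simp only [Finset.mem_range] at hk
    have : n + 1 - 1 - k = n - k := by omega
    rw [this, Polynomial.mul_comp, bernsteinPolynomial.flip _ _ _ (by omega), Polynomial.natCast_comp]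
    congr 2; omega
  have h2 : ∀ k ∈ Finset.range (n+1), (EN n (n-k) : ℝ[X]) * bernsteinPolynomial ℝ n k
     = (EN (n+1) k : ℝ[X]) * bernsteinPolynomial ℝ n k - (EN (n+1) (k+1) : ℝ[X]) * bernsteinPolynomial ℝ n k := by
    intro k hk
    simp only [Finset.mem_range] at hk
    rw [EN_diff n k (by omega)]
    push_cast; ring
  have h3 : ∑ k ∈ Finset.range (n+1), (EN (n+1) k : ℝ[X]) * bernsteinPolynomial ℝ n k
     = ∑ k ∈ Finset.range (n+1), (EN (n+1) (k+1) : ℝ[X]) * bernsteinPolynomial ℝ n (k+1) + (EN (n+1) 0 : ℝ[X]) * bernsteinPolynomial ℝ n 0 := by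
    rw [← Finset.sum_range_succ' (fun k => (EN (n+1) k : ℝ[X]) * bernsteinPolynomial ℝ n k), Finset.sum_range_succ _ (n+1),
      bernsteinPolynomial.eq_zero_of_lt _ (by omega : n < n+1)]
    simp
  rw [h1, Finset.sum_congr rfl h2, Finset.sum_sub_distrib, h3, Q, Finset.sum_range_succ']
  simp only [Polynomial.derivative_add, Polynomial.derivative_sum, Polynomial.derivative_mul, Polynomial.derivative_natCast,
    bernsteinPolynomial.derivative_succ, bernsteinPolynomial.derivative_zero, zero_mul, zero_add, Nat.add_sub_cancel]
  have h4 : ∀ k, (EN (n+1) (k+1) : ℝ[X]) * (((n+1:ℕ):ℝ[X]) * (bernsteinPolynomial ℝ n k - bernsteinPolynomial ℝ n (k+1)))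
    = ((n:ℝ[X])+1) * ((EN (n+1) (k+1) : ℝ[X]) * bernsteinPolynomial ℝ n k) - ((n:ℝ[X])+1) * ((EN (n+1) (k+1) : ℝ[X]) * bernsteinPolynomial ℝ n (k+1)) := by
    intro k; push_cast; ring
  simp only [h4, Finset.sum_sub_distrib, ← Finset.mul_sum]
  push_cast
  ring

theorem Q_hasDeriv (n : ℕ) (x : ℝ) : HasDerivAt (fun y => (Q (n+1)).eval y) (-((n:ℝ)+1) * (Q n).eval (1-x)) x := by
  have := (Q (n+1)).hasDerivAt x
  rw [Q_deriv] at this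
  simpa using this
open Real in
noncomputable def trm (n k : ℕ) (x : ℝ) : ℝ :=
  (4/π) * (-1)^(k*(n+1)) * (2/π)^n / (2*(k:ℝ)+1)^(n+1) * cos ((2*(k:ℝ)+1)*π*x/2)

open Real in
theorem summable_bd (n : ℕ) (hn : 1 ≤ n) :
    Summable (fun k : ℕ => (4/π) * (2/π)^n * (1 / (2*(k:ℝ)+1)^(n+1))) := by
  apply Summable.mul_left
  have h := (summable_nat_add_iff 1).mpr (Real.summable_one_div_nat_pow.mpr (by omega : 1 < n+1))
  refine Summable.of_nonneg_of_le (fun k => by positivity) (fun k => ?_) h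
  push_cast
  gcongr
  have : (0:ℝ) ≤ k := by positivity
  linarith

open Real in
theorem trm_bd (n k : ℕ) (x : ℝ) : ‖trm n k x‖ ≤ (4/π) * (2/π)^n * (1 / (2*(k:ℝ)+1)^(n+1)) := by
  have hp := pi_pos
  have h1 : (0:ℝ) < 2 * k + 1 := by positivity
  rw [trm, norm_mul, norm_div, norm_mul, norm_mul, norm_pow, norm_pow, norm_pow, norm_neg, norm_one, one_pow, mul_one,
    norm_of_nonneg (by positivity : 0 ≤ 4/π), norm_of_nonneg (by positivity : 0 ≤ 2/π), norm_of_nonneg h1.le]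
  have := abs_cos_le_one ((2*(k:ℝ)+1)*π*x/2)
  rw [← Real.norm_eq_abs] at this
  calc _ ≤ 4 / π * (2 / π) ^ n / (2 * (k:ℝ) + 1) ^ (n + 1) * 1 := by gcongr
    _ = _ := by ring

theorem trm_summable (n : ℕ) (hn : 1 ≤ n) (x : ℝ) : Summable (fun k => trm n k x) :=
  Summable.of_norm_bounded (summable_bd n hn) (fun k => trm_bd n k x)

open Real in
theorem cos_odd (k : ℕ) (x : ℝ) : cos ((2*(k:ℝ)+1)*π*(1-x)/2) = (-1)^k * sin ((2*(k:ℝ)+1)*π*x/2) := by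
  have : (2*(k:ℝ)+1)*π*(1-x)/2 = (π/2 - (2*(k:ℝ)+1)*π*x/2) + k * π := by ring
  rw [this, cos_add_nat_mul_pi, cos_pi_div_two_sub]

open Real in
theorem trm_deriv (n k : ℕ) (x : ℝ) : HasDerivAt (trm (n+1) k) (-trm n k (1-x)) x := by
  have hp := pi_ne_zero
  have h1 : (2:ℝ) * k + 1 ≠ 0 := by positivity
  have h := (((((hasDerivAt_id x).const_mul ((2*(k:ℝ)+1)*π)).div_const 2).cos).const_mul
    ((4/π) * (-1)^(k*(n+1+1)) * (2/π)^(n+1) / (2*(k:ℝ)+1)^(n+1+1)))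
  refine h.congr_deriv ?_
  rw [trm, cos_odd]
  have e : k * (n+1+1) = k * (n+1) + k := by ring
  rw [e, pow_add _ (k*(n+1)) k]
  simp only [id]
  rw [pow_succ (2/π) n, pow_succ (2*(k:ℝ)+1) (n+1)]
  field_simp

theorem S_deriv (n : ℕ) (hn : 1 ≤ n) (x : ℝ) :
    HasDerivAt (fun z => ∑' k, trm (n+1) k z) (-∑' k, trm n k (1-x)) x := by
  rw [← tsum_neg]
  refine hasDerivAt_tsum (g' := fun k y => -trm n k (1-y)) (y₀ := 0) (summable_bd n hn) (fun k y => trm_deriv n k y) ?_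
    (trm_summable _ (by omega) _) x
  intro k y
  rw [norm_neg]
  exact trm_bd _ _ _

theorem S_one (n : ℕ) : ∑' k, trm n k 1 = 0 := by
  have : ∀ k, trm n k 1 = 0 := by
    intro k
    have := cos_odd k 0
    rw [trm]
    simp at this ⊢
    simp [this]
  simp [this]

open Real in
theorem S_first (x : ℝ) (hx : x ∈ Set.Icc (0:ℝ) 1) : ∑' k, trm 1 k x = 1 - x := by
  have hp := pi_ne_zero
  have B : ∀ y ∈ Set.Icc (0:ℝ) 1, HasSum (fun n : ℕ => 1 / (n : ℝ) ^ 2 * cos (2 * π * n * y)) (π^2 * (y^2 - y + 6⁻¹)) := by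
    intro y hy
    have := hasSum_one_div_nat_pow_mul_cos one_ne_zero hy
    have h2 := bernoulliFun_two y
    rw [bernoulliFun] at h2
    rw [mul_one, h2] at this
    convert this using 1
    simp only [Nat.factorial]
    push_cast
    ring
  obtain ⟨h0, h1⟩ := hx
  have F := B (x/4) ⟨by linarith, by linarith⟩
  have G := (B (x/2) ⟨by linarith, by linarith⟩).mul_left (1/4)
  have hodd : Summable (fun k : ℕ => 1 / ((2*k+1 : ℕ) : ℝ) ^ 2 * cos (2 * π * (2*k+1 : ℕ) * (x/4))) :=
    F.summable.comp_injective (i := fun k : ℕ => 2*k+1) (fun a b h => by simpa using h)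
  have G' : HasSum (fun k : ℕ => 1 / ((2*k : ℕ) : ℝ) ^ 2 * cos (2 * π * (2*k : ℕ) * (x/4))) (1/4 * (π^2 * ((x/2)^2 - x/2 + 6⁻¹))) := by
    refine Eq.mp (congrArg (fun f : ℕ → ℝ => HasSum f _) (funext fun k => ?_)) G
    symm
    push_cast
    have : 2 * π * (2 * (k:ℝ)) * (x / 4) = 2 * π * k * (x/2) := by ring
    rw [this, mul_pow, one_div, one_div, mul_inv]
    ring
  have H := F.unique (HasSum.even_add_odd (f := fun n : ℕ => 1 / (n : ℝ) ^ 2 * cos (2 * π * n * (x/4))) G' hodd.hasSum)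
  have T : ∀ k, trm 1 k x = 8/π^2 * (1 / ((2*k+1 : ℕ) : ℝ) ^ 2 * cos (2 * π * (2*k+1 : ℕ) * (x/4))) := by
    intro k
    have e : 2 * π * ((2*k+1 : ℕ) : ℝ) * (x/4) = (2*(k:ℝ)+1)*π*x/2 := by push_cast; ring
    rw [e, trm]
    have : (-1:ℝ)^(k*(1+1)) = 1 := by rw [mul_comm, pow_mul]; simp
    rw [this]
    push_cast
    field_simp
    ring
  simp only [T]
  rw [tsum_mul_left]
  have : (∑' k : ℕ, 1 / ((2*k+1 : ℕ) : ℝ) ^ 2 * cos (2 * π * (2*k+1 : ℕ) * (x/4))) = π^2 * ((1-x)/8) := by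
    linarith
  rw [this]
  field_simp

theorem Q_eq_S (n : ℕ) : ∀ x ∈ Set.Icc (0:ℝ) 1,
    (Q (n+1)).eval x = (Nat.factorial (n+1)) * ∑' k, trm (n+1) k x := by
  induction n with
  | zero => intro x hx; rw [zero_add, S_first x hx, Q_first]; simp
  | succ n ih =>
    have hd : ∀ x ∈ Set.Icc (0:ℝ) 1, HasDerivAt (fun y => (Q (n+1+1)).eval y -
        (Nat.factorial (n+1+1)) * ∑' k, trm (n+1+1) k y) 0 x := by
      intro x hx
      refine ((Q_hasDeriv (n+1) x).sub ((S_deriv (n+1) (by omega) x).const_mul _)).congr_deriv ?_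
      rw [ih (1-x) ⟨by linarith [hx.2], by linarith [hx.1]⟩, Nat.factorial_succ (n+1)]
      push_cast
      ring
    have hc := constant_of_has_deriv_right_zero (fun x hx => (hd x hx).continuousAt.continuousWithinAt)
      (fun x hx => (hd x ⟨hx.1, hx.2.le⟩).hasDerivWithinAt)
    have h1 := hc 1 ⟨by norm_num, le_rfl⟩
    intro x hx
    have h2 := hc x hx
    simp only [S_one, Q_one] at h1
    linarith

/-- **Elkies's series formula for the up-down numbers**:
`A_n = (2^{n+2} n! / π^{n+1}) Σ_{k≥1} (−1)^{(k−1)(n−1)} / (2k−1)^{n+1}`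
(the series, reindexed by `k ← k+1`, converges). -/
theorem updown_series (n : ℕ) (hn : 1 ≤ n) :
    Summable (fun k : ℕ =>
      (-1 : ℝ) ^ (k * (n - 1)) / (2 * (k : ℝ) + 1) ^ (n + 1)) ∧
    (updownCount n : ℝ) =
      (2 ^ (n + 2) * (Nat.factorial n : ℝ) / Real.pi ^ (n + 1)) *
        ∑' k : ℕ, (-1 : ℝ) ^ (k * (n - 1)) / (2 * (k : ℝ) + 1) ^ (n + 1) := by
  have hp := Real.pi_ne_zero
  have key : ∀ k, trm n k 0 = (2 ^ (n+2) / Real.pi ^ (n+1)) *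
      ((-1 : ℝ) ^ (k * (n - 1)) / (2 * (k : ℝ) + 1) ^ (n + 1)) := by
    intro k
    have e : k * (n+1) = k * (n-1) + 2 * k := by
      obtain ⟨m, rfl⟩ : ∃ m, n = m + 1 := ⟨n-1, by omega⟩
      simp only [Nat.add_sub_cancel]; ring
    have e2 : (-1:ℝ)^(k*(n+1)) = (-1)^(k*(n-1)) := by
      rw [e, pow_add, pow_mul _ 2 k]; simp
    rw [trm, e2]
    simp only [mul_zero, zero_div, Real.cos_zero, mul_one]
    rw [div_pow]
    field_simp
    ring
  have hc : (2:ℝ) ^ (n+2) / Real.pi ^ (n+1) ≠ 0 := by positivity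
  constructor
  · have := trm_summable n hn 0
    simp only [key] at this
    exact (summable_mul_left_iff hc).mp this
  · obtain ⟨m, rfl⟩ : ∃ m, n = m + 1 := ⟨n-1, by omega⟩
    have h := Q_eq_S m 0 ⟨le_rfl, zero_le_one⟩
    rw [Q_zero] at h
    simp only [key] at h
    rw [updown_eq, h, tsum_mul_left]
    ring
end
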